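/- arXiv:2005.07015 — 3 statements merged into one kernel-verified Lean document; each statement's English description precedes it below -/
import Mathlib

section
/- Let n, m, ν be reals with m + ν > 2 and n + ν > 2, let b > 0 and c > 0 be reals, and let f : ℝ → ℝ be a nonnegative measurable function. Then ∫₀^∞ ∫₀^∞ x^(-n/2)·y^(-m/2)·(x+y)^(-ν/2) · f(xy/(x+y)) · exp(-b/x - b/y - c·xy/(x+y)) dx dy = (Γ((m+ν-2)/2)·Γ((n+ν-2)/2)/Γ((m+n+2·ν-4)/2)) · ∫₀^∞ f(t) · exp(-c·t) · exp(-b/t) · t^((-m-n-ν+2)/2) dt, where Γ denotes the Gamma function. -/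
open MeasureTheory Real

lemma aux_inner (G : ℝ → ENNReal) (x : ℝ) (hx : 0 < x) :
    ∫⁻ y in Set.Ioi (0:ℝ), G y =
      ∫⁻ s in Set.Ioo (0:ℝ) 1, ENNReal.ofReal (x / s ^ 2) * G (x * (1 - s) / s) := by
  have himg : (fun s : ℝ => x * (1 - s) / s) '' Set.Ioo (0:ℝ) 1 = Set.Ioi 0 := by
    ext y
    constructor
    · rintro ⟨s, ⟨h0, h1⟩, rfl⟩
      have : 0 < 1 - s := by linarith
      simp only [Set.mem_Ioi]
      positivity
    · intro hy
      have hy : 0 < y := hy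
      refine ⟨x / (x + y), ⟨by positivity, ?_⟩, ?_⟩
      · rw [div_lt_one (by positivity)]; linarith
      · simp only
        field_simp
        ring
  have h := lintegral_image_eq_lintegral_abs_deriv_mul (s := Set.Ioo (0:ℝ) 1)
    (f := fun s : ℝ => x * (1 - s) / s) (f' := fun s => -(x / s ^ 2)) measurableSet_Ioo
    (fun s hs => by
      have hs0 : s ≠ 0 := hs.1.ne'
      have := (((hasDerivAt_id s).const_sub 1).const_mul x).div (hasDerivAt_id s) hs0
      refine (this.congr_deriv ?_).hasDerivWithinAt
      simp only [id]
      field_simp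
      ring)
    (fun s hs r hr h => by
      have hs0 : s ≠ 0 := hs.1.ne'
      have hr0 : r ≠ 0 := hr.1.ne'
      simp only at h
      field_simp at h
      linarith) G
  rw [himg] at h
  rw [h]
  refine setLIntegral_congr_fun measurableSet_Ioo fun s hs => ?_
  have : 0 < s := hs.1
  simp only [abs_neg]
  rw [abs_of_nonneg (by positivity)]

lemma aux_scale (G : ℝ → ENNReal) (a : ℝ) (ha : 0 < a) :
    ∫⁻ x in Set.Ioi (0:ℝ), G x =
      ∫⁻ t in Set.Ioi (0:ℝ), ENNReal.ofReal (1 / a) * G (t / a) := by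
  have himg : (fun t : ℝ => t / a) '' Set.Ioi (0:ℝ) = Set.Ioi 0 := by
    ext y
    constructor
    · rintro ⟨s, h0, rfl⟩
      exact div_pos h0 ha
    · intro hy
      exact ⟨y * a, mul_pos hy ha, by simp only; field_simp⟩
  have h := lintegral_image_eq_lintegral_abs_deriv_mul (s := Set.Ioi (0:ℝ))
    (f := fun t : ℝ => t / a) (f' := fun t => 1 / a) measurableSet_Ioi
    (fun s hs => ((hasDerivAt_id s).div_const a).hasDerivWithinAt)
    (fun s hs r hr h => by
      simp only at h
      field_simp at h
      linarith) G
  rw [himg] at h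
  rw [h, abs_of_nonneg (by positivity)]

lemma aux_cov (F : ℝ → ℝ → ENNReal) (hF : Measurable (Function.uncurry F)) :
    ∫⁻ x in Set.Ioi (0:ℝ), ∫⁻ y in Set.Ioi (0:ℝ), F x y =
      ∫⁻ s in Set.Ioo (0:ℝ) 1, ∫⁻ t in Set.Ioi (0:ℝ),
        ENNReal.ofReal (1 / (1 - s)) * (ENNReal.ofReal (t / (1 - s) / s ^ 2) *
          F (t / (1 - s)) (t / (1 - s) * (1 - s) / s)) := by
  rw [setLIntegral_congr_fun measurableSet_Ioi (fun x hx => aux_inner (F x) x hx)]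
  rw [lintegral_lintegral_swap]
  · refine setLIntegral_congr_fun measurableSet_Ioo fun s hs => ?_
    have : 0 < 1 - s := by linarith [hs.2]
    exact aux_scale (fun x => ENNReal.ofReal (x / s ^ 2) * F x (x * (1 - s) / s)) _ this
  · apply Measurable.aemeasurable
    have : Measurable (fun p : ℝ × ℝ => F p.1 (p.1 * (1 - p.2) / p.2)) :=
      hF.comp (by fun_prop : Measurable fun p : ℝ × ℝ => (p.1, p.1 * (1 - p.2) / p.2))
    exact Measurable.mul (by fun_prop) this

lemma aux_beta (p q : ℝ) (hp : 0 < p) (hq : 0 < q) :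
    ∫⁻ s in Set.Ioo (0:ℝ) 1, ENNReal.ofReal (s ^ (p - 1) * (1 - s) ^ (q - 1)) =
      ENNReal.ofReal (Real.Gamma p * Real.Gamma q / Real.Gamma (p + q)) := by
  have h := ProbabilityTheory.lintegral_betaPDF_eq_one hp hq
  have hb := ProbabilityTheory.beta_pos hp hq
  rw [ProbabilityTheory.lintegral_betaPDF] at h
  change _ = ENNReal.ofReal (ProbabilityTheory.beta p q)
  rw [← mul_one (ENNReal.ofReal (ProbabilityTheory.beta p q)), ← h,
    ← lintegral_const_mul _ (by fun_prop)]
  refine setLIntegral_congr_fun measurableSet_Ioo fun s hs => ?_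
  rw [← ENNReal.ofReal_mul hb.le]
  congr 1
  field_simp

lemma aux_point (n m ν b c t s : ℝ) (f : ℝ → ℝ) (ht : 0 < t) (hs : 0 < s) (hs1 : s < 1) :
    1 / (1 - s) * (t / (1 - s) / s ^ 2 * ((t / (1 - s)) ^ (-n/2) * (t / s) ^ (-m/2) *
      (t / (1 - s) + t / s) ^ (-ν/2) * f ((t / (1 - s)) * (t / s) / (t / (1 - s) + t / s)) *
      Real.exp (-b / (t / (1 - s)) - b / (t / s) -
        c * ((t / (1 - s)) * (t / s) / (t / (1 - s) + t / s))))) =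
    (s ^ ((m + ν - 2) / 2 - 1) * (1 - s) ^ ((n + ν - 2) / 2 - 1)) *
      (f t * Real.exp (-c * t) * Real.exp (-b / t) * t ^ ((-m - n - ν + 2) / 2)) := by
  have h1 : 0 < 1 - s := by linarith
  have e1 : t / (1 - s) + t / s = t / ((1 - s) * s) := by field_simp; ring
  have e2 : (t / (1 - s)) * (t / s) / (t / ((1 - s) * s)) = t := by field_simp
  have e3 : -b / (t / (1 - s)) - b / (t / s) - c * t = -c * t + -b / t := by
    field_simp; ring
  rw [e1, e2, e3, Real.exp_add]
  have key : 1 / (1 - s) * (t / (1 - s) / s ^ 2) * ((t / (1 - s)) ^ (-n/2) * (t / s) ^ (-m/2) *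
      (t / ((1 - s) * s)) ^ (-ν/2)) =
      s ^ ((m + ν - 2) / 2 - 1) * (1 - s) ^ ((n + ν - 2) / 2 - 1) *
        t ^ ((-m - n - ν + 2) / 2) := by
    generalize 1 - s = r at h1
    obtain ⟨u, rfl⟩ : ∃ u, Real.exp u = r := ⟨_, Real.exp_log h1⟩
    obtain ⟨v, rfl⟩ : ∃ v, Real.exp v = s := ⟨_, Real.exp_log hs⟩
    obtain ⟨w, rfl⟩ : ∃ w, Real.exp w = t := ⟨_, Real.exp_log ht⟩
    rw [one_div, ← Real.exp_neg, pow_two]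
    simp only [← Real.exp_add, ← Real.exp_sub, ← Real.exp_mul]
    congr 1
    ring
  linear_combination (f t * Real.exp (-c * t) * Real.exp (-b / t)) * key

theorem stmt_17 (n m ν : ℝ) (hmν : m + ν > 2) (hnν : n + ν > 2)
    (b c : ℝ) (hb : 0 < b) (hc : 0 < c) (f : ℝ → ℝ)
    (hf : Measurable f) (hf0 : ∀ t, 0 ≤ f t) :
    (∫⁻ x in Set.Ioi (0:ℝ), ∫⁻ y in Set.Ioi (0:ℝ),
        ENNReal.ofReal (x ^ (-n/2) * y ^ (-m/2) * (x + y) ^ (-ν/2) *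
          f (x * y / (x + y)) *
          Real.exp (-b / x - b / y - c * (x * y / (x + y)))))
    = ENNReal.ofReal (Real.Gamma ((m + ν - 2) / 2) * Real.Gamma ((n + ν - 2) / 2) /
        Real.Gamma ((m + n + 2 * ν - 4) / 2)) *
      ∫⁻ t in Set.Ioi (0:ℝ),
        ENNReal.ofReal (f t * Real.exp (-c * t) * Real.exp (-b / t) *
          t ^ ((-m - n - ν + 2) / 2)) := by
  rw [aux_cov (fun x y => ENNReal.ofReal (x ^ (-n/2) * y ^ (-m/2) * (x + y) ^ (-ν/2) *
          f (x * y / (x + y)) *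
          Real.exp (-b / x - b / y - c * (x * y / (x + y)))))
      (by unfold Function.uncurry; fun_prop)]
  have e : (m + n + 2 * ν - 4) / 2 = (m + ν - 2) / 2 + (n + ν - 2) / 2 := by ring
  rw [e, ← aux_beta _ _ (by linarith) (by linarith), ← lintegral_mul_const _ (by fun_prop)]
  refine setLIntegral_congr_fun measurableSet_Ioo fun s hs => ?_
  rw [← lintegral_const_mul _ (by fun_prop)]
  refine setLIntegral_congr_fun measurableSet_Ioi fun t ht => ?_
  have ht : 0 < t := ht
  have h0 : 0 < s := hs.1
  have h1 : 0 < 1 - s := by linarith [hs.2]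
  rw [← ENNReal.ofReal_mul (by positivity), ← ENNReal.ofReal_mul (by positivity),
    ← ENNReal.ofReal_mul (by positivity), ← aux_point n m ν b c t s f ht h0 hs.2,
    div_mul_cancel₀ _ h1.ne']
end

section
/- Let η₁, η₂ be positive reals with η₁ ≠ η₂, and let x₂ be a nonzero vector in ℝ³. Then the integral over all of ℝ³ of (exp(-η₁·‖x‖)/‖x‖)·(exp(-η₂·‖x - x₂‖)/‖x - x₂‖) with respect to x equals 4·π·(exp(-η₁·‖x₂‖) - exp(-η₂·‖x₂‖))/(‖x₂‖·(η₂² - η₁²)). -/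
open MeasureTheory Real

lemma lemA (G : ℝ → ℝ → ENNReal) (hG : Measurable (Function.uncurry G))
    (x₂ : EuclideanSpace ℝ (Fin 3)) (hx₂ : x₂ ≠ 0) :
    ∫⁻ x : EuclideanSpace ℝ (Fin 3), G ‖x‖ ‖x - x₂‖ =
    ∫⁻ z : ℝ, ∫⁻ p : ℝ × ℝ, G (√(z^2+(p.1^2+p.2^2))) (√((z-‖x₂‖)^2+(p.1^2+p.2^2))) := by
  have hR : ‖x₂‖ ≠ 0 := norm_ne_zero_iff.mpr hx₂
  obtain ⟨b, hb⟩ := Orthonormal.exists_orthonormalBasis_extension_of_card_eq (𝕜 := ℝ)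
    (E := EuclideanSpace ℝ (Fin 3)) (ι := Fin 3) (by simp)
    (v := fun _ => (‖x₂‖⁻¹ • x₂ : EuclideanSpace ℝ (Fin 3))) (s := {0}) (by
      constructor
      · rintro ⟨i, hi⟩
        simp [norm_smul, hR]
      · rintro ⟨i, hi⟩ ⟨j, hj⟩ hij
        exfalso; apply hij; ext; simp at hi hj; simp [hi, hj])
  have hb0 : b 0 = ‖x₂‖⁻¹ • x₂ := hb 0 (by simp)
  have hx : b.repr x₂ = EuclideanSpace.single 0 ‖x₂‖ := by
    have : x₂ = ‖x₂‖ • b 0 := by rw [hb0, smul_smul, mul_inv_cancel₀ hR, one_smul]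
    conv_lhs => rw [this]
    rw [map_smul, b.repr_self]
    ext i
    simp
  have h1 : ∀ x, G ‖x‖ ‖x - x₂‖ = 
     (fun y : EuclideanSpace ℝ (Fin 3) => G ‖y‖ ‖y - EuclideanSpace.single 0 ‖x₂‖‖) (b.repr x) := by
    intro x
    simp only
    rw [← hx, ← map_sub, LinearIsometryEquiv.norm_map, LinearIsometryEquiv.norm_map]
  simp_rw [h1]
  have e1 := b.measurePreserving_repr
  rw [e1.lintegral_comp (f := fun y : EuclideanSpace ℝ (Fin 3) => G ‖y‖ ‖y - EuclideanSpace.single 0 ‖x₂‖‖)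
    (hG.comp (f := fun y : EuclideanSpace ℝ (Fin 3) => (‖y‖, ‖y - EuclideanSpace.single 0 ‖x₂‖‖)) (by fun_prop))]
  have hm : Measurable (fun q : ℝ × (ℝ × ℝ) => G (√(q.1^2+(q.2.1^2+q.2.2^2))) (√((q.1-‖x₂‖)^2+(q.2.1^2+q.2.2^2)))) :=
    hG.comp (f := fun q : ℝ × (ℝ × ℝ) => ((√(q.1^2+(q.2.1^2+q.2.2^2))), (√((q.1-‖x₂‖)^2+(q.2.1^2+q.2.2^2))))) (by fun_prop)
  have e2 := ((MeasurePreserving.id (volume : Measure ℝ)).prod (volume_preserving_finTwoArrow ℝ)).comp ((volume_preserving_piFinSuccAbove (fun _ : Fin 3 => ℝ) 0).comp (PiLp.volume_preserving_ofLp (Fin 3)))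
  have e3 := e2.lintegral_comp hm
  rw [lintegral_prod _ hm.aemeasurable] at e3
  refine Eq.trans ?_ e3
  apply lintegral_congr
  intro y
  rw [EuclideanSpace.norm_eq, EuclideanSpace.norm_eq]
  simp [Fin.sum_univ_three, MeasurableEquiv.piFinSuccAbove, MeasurableEquiv.finTwoArrow, Fin.insertNthEquiv, add_assoc]
  rfl

lemma lemB (H : ℝ → ENNReal) (hH : Measurable H) :
    ∫⁻ p : ℝ × ℝ, H (p.1^2+p.2^2) = ENNReal.ofReal (2*π) * ∫⁻ ρ in Set.Ioi (0:ℝ), ENNReal.ofReal ρ * H (ρ^2) := by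
  rw [← lintegral_comp_polarCoord_symm]
  have : ∀ p : ℝ × ℝ, ENNReal.ofReal p.1 • H ((polarCoord.symm p).1^2 + (polarCoord.symm p).2^2)
     = ENNReal.ofReal p.1 * H (p.1^2) := by
    intro p
    rw [polarCoord_symm_apply, smul_eq_mul]
    congr 2
    simp only
    nlinarith [Real.sin_sq_add_cos_sq p.2]
  simp_rw [this]
  rw [polarCoord_target, Measure.volume_eq_prod, ← Measure.prod_restrict, lintegral_prod _ (by fun_prop)]
  simp only [lintegral_const]
  rw [lintegral_mul_const _ (by fun_prop), mul_comm]
  congr 1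
  simp only [Measure.restrict_apply_univ, Real.volume_Ioo]
  congr 1; ring

lemma lemC (H : ℝ → ENNReal) (z : ℝ) :
    ∫⁻ ρ in Set.Ioi (0:ℝ), ENNReal.ofReal ρ * H (ρ^2)
    = ∫⁻ r in Set.Ioi |z|, ENNReal.ofReal r * H (r^2-z^2) := by
  have himg : (fun ρ : ℝ => √(ρ^2+z^2)) '' Set.Ioi 0 = Set.Ioi |z| := by
    ext r
    simp only [Set.mem_image, Set.mem_Ioi]
    constructor
    · rintro ⟨ρ, h, rfl⟩
      apply Real.lt_sqrt_of_sq_lt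
      rw [sq_abs]; nlinarith
    · intro h
      have hr : 0 < r := lt_of_le_of_lt (abs_nonneg z) h
      have : z^2 < r^2 := sq_lt_sq.mpr (by rwa [abs_of_pos hr])
      refine ⟨√(r^2-z^2), Real.sqrt_pos.mpr (by linarith), ?_⟩
      rw [Real.sq_sqrt (by linarith), sub_add_cancel, Real.sqrt_sq hr.le]
  have hpos : ∀ ρ ∈ Set.Ioi (0:ℝ), 0 < ρ^2+z^2 := by
    intro ρ (h : 0 < ρ); positivity
  rw [← himg, lintegral_image_eq_lintegral_abs_deriv_mul (f' := fun ρ => ρ / √(ρ^2+z^2)) measurableSet_Ioi]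
  · apply setLIntegral_congr_fun measurableSet_Ioi
    intro ρ h
    have h' := hpos ρ h
    have h0 : 0 < ρ := h
    simp only
    have hs := Real.sqrt_pos.mpr h'
    rw [Real.sq_sqrt h'.le, add_sub_cancel_right, ← mul_assoc, ← ENNReal.ofReal_mul (abs_nonneg _),
      abs_of_pos (by positivity), div_mul_cancel₀ _ hs.ne']
  · intro ρ h
    have h' := hpos ρ h
    have := ((((hasDerivAt_id ρ).pow 2).add_const (z^2)).sqrt h'.ne').hasDerivWithinAt (s := Set.Ioi 0)
    refine HasDerivWithinAt.congr_deriv this ?_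
    have hs := Real.sqrt_pos.mpr h'
    simp only [id, Pi.pow_apply]
    field_simp
    norm_num
  · intro a ha b hb hab
    replace hab : √(a^2+z^2) = √(b^2+z^2) := hab
    have h1 := hpos a ha
    have h2 := hpos b hb
    rw [Real.sqrt_inj h1.le h2.le] at hab
    have ha' : 0 < a := ha
    have hb' : 0 < b := hb
    nlinarith

/-- cylindrical/spherical reduction -/
lemma lemD (G : ℝ → ℝ → ENNReal) (hG : Measurable (Function.uncurry G))
    (x₂ : EuclideanSpace ℝ (Fin 3)) (hx₂ : x₂ ≠ 0) :
    ∫⁻ x : EuclideanSpace ℝ (Fin 3), G ‖x‖ ‖x - x₂‖ =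
    ENNReal.ofReal (2*π) * ∫⁻ r in Set.Ioi (0:ℝ), ENNReal.ofReal r *
      ∫⁻ z in Set.Ioo (-r) r, G r (√(r^2 - 2*z*‖x₂‖+‖x₂‖^2)) := by
  rw [lemA G hG x₂ hx₂]
  set R := ‖x₂‖
  have h1 : ∀ z : ℝ, ∫⁻ p : ℝ × ℝ, G (√(z^2+(p.1^2+p.2^2))) (√((z-R)^2+(p.1^2+p.2^2)))
      = ENNReal.ofReal (2*π) * ∫⁻ r in Set.Ioi |z|, ENNReal.ofReal r * G r (√(r^2 - 2*z*R+R^2)) := by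
    intro z
    rw [lemB (fun t => G (√(z^2+t)) (√((z-R)^2+t)))
      (hG.comp (f := fun t : ℝ => ((√(z^2+t)), (√((z-R)^2+t)))) (by fun_prop)),
      lemC (fun t => G (√(z^2+t)) (√((z-R)^2+t))) z]
    congr 1
    apply setLIntegral_congr_fun measurableSet_Ioi
    intro r hr
    have hr : 0 < r := lt_of_le_of_lt (abs_nonneg z) hr
    simp only
    rw [add_sub_cancel, Real.sqrt_sq hr.le]
    congr 3
    ring
  simp_rw [h1]
  rw [lintegral_const_mul' _ _ ENNReal.ofReal_ne_top]
  congr 1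
  let K : ℝ → ℝ → ENNReal := fun z r => ENNReal.ofReal r * G r (√(r^2 - 2*z*R+R^2))
  have hK : Measurable (Function.uncurry K) := by
    apply Measurable.mul (by fun_prop)
    exact hG.comp (f := fun q : ℝ × ℝ => (q.2, √(q.2^2 - 2*q.1*R+R^2))) (by fun_prop)
  have hS : MeasurableSet {q : ℝ × ℝ | |q.1| < q.2} :=
    measurableSet_lt (by fun_prop) (by fun_prop)
  have h2 : ∀ z, ∫⁻ r in Set.Ioi |z|, K z r = ∫⁻ r, ({q : ℝ × ℝ | |q.1| < q.2}.indicator (Function.uncurry K)) (z, r) := by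
    intro z
    rw [← lintegral_indicator measurableSet_Ioi]
    rfl
  change ∫⁻ z, ∫⁻ r in Set.Ioi |z|, K z r = _
  simp_rw [h2]
  rw [lintegral_lintegral_swap (f := fun z r => ({q : ℝ × ℝ | |q.1| < q.2}.indicator (Function.uncurry K)) (z, r)) (hK.indicator hS).aemeasurable, ← lintegral_indicator measurableSet_Ioi]
  apply lintegral_congr
  intro r
  by_cases hr : 0 < r
  · rw [Set.indicator_of_mem (by exact hr), ← lintegral_const_mul' _ _ ENNReal.ofReal_ne_top,
      ← lintegral_indicator measurableSet_Ioo]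
    apply lintegral_congr
    intro z
    simp only [Set.indicator_apply, Set.mem_ofPred_eq, abs_lt, Set.mem_Ioo]
    rfl
  · rw [Set.indicator_of_notMem (by exact hr)]
    rw [lintegral_eq_zero_of_ae_eq_zero]
    filter_upwards with z
    rw [Set.indicator_of_notMem]
    · rfl
    · intro (h : |z| < r)
      exact hr (lt_of_le_of_lt (abs_nonneg z) h)

lemma lemE (η R r : ℝ) (hη : 0 < η) (hR : 0 < R) (hr : 0 < r) (hne : r ≠ R) :
    ∫⁻ z in Set.Ioo (-r) r, ENNReal.ofReal (exp (-η * √(r^2 - 2*z*R+R^2)) / √(r^2 - 2*z*R+R^2))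
    = ENNReal.ofReal ((exp (-η * |r-R|) - exp (-η * (r+R))) / (η * R)) := by
  have hpos : ∀ z ∈ Set.Icc (-r) r, 0 < r^2 - 2*z*R+R^2 := by
    intro z hz
    have : 0 < (r-R)^2 := by have := sub_ne_zero.mpr hne; positivity
    nlinarith [hz.1, hz.2]
  have hc : ContinuousOn (fun z => exp (-η * √(r^2 - 2*z*R+R^2)) / √(r^2 - 2*z*R+R^2)) (Set.Icc (-r) r) := by
    apply ContinuousOn.div (by fun_prop) (by fun_prop)
    intro z hz
    exact (Real.sqrt_pos.mpr (hpos z hz)).ne'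
  have hle : -r ≤ r := by linarith
  rw [← ofReal_integral_eq_lintegral_ofReal]
  · congr 1
    rw [← integral_Ioc_eq_integral_Ioo, ← intervalIntegral.integral_of_le hle,
      intervalIntegral.integral_eq_sub_of_hasDerivAt (f := fun z => exp (-η * √(r^2 - 2*z*R+R^2)) / (η * R))]
    · have e1 : r^2 - 2*r*R+R^2 = (r-R)^2 := by ring
      have e2 : r^2 - 2*(-r)*R+R^2 = (r+R)^2 := by ring
      simp only [e1, e2]
      rw [Real.sqrt_sq_eq_abs, Real.sqrt_sq (by linarith)]
      ring
    · intro z hz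
      rw [Set.uIcc_of_le hle] at hz
      have hp := hpos z hz
      have hs := Real.sqrt_pos.mpr hp
      have h0 : HasDerivAt (fun z : ℝ => r^2 - 2*z*R+R^2) (-(2*R)) z := by
        have := ((((hasDerivAt_id z).const_mul 2).mul_const R).const_sub (r^2)).add_const (R^2)
        exact this.congr_deriv (by ring)
      have := (((h0.sqrt hp.ne').const_mul (-η)).exp).div_const (η * R)
      refine this.congr_deriv ?_
      field_simp
    · apply ContinuousOn.intervalIntegrable
      rwa [Set.uIcc_of_le hle]
  · exact (hc.integrableOn_Icc).mono_set Set.Ioo_subset_Icc_self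
  · filter_upwards with z
    simp only [Pi.zero_apply]
    positivity

lemma lemF (a b R : ℝ) (ha : 0 < a) (hb : 0 < b) (hab : a ≠ b) (hR : 0 < R) :
    IntegrableOn (fun r => exp (-a*r) * ((exp (-b * |r-R|) - exp (-b * (r+R))) / (b * R))) (Set.Ioi 0) ∧
    ∫ r in Set.Ioi 0, exp (-a*r) * ((exp (-b * |r-R|) - exp (-b * (r+R))) / (b * R))
    = 2 * (exp (-a*R) - exp (-b*R)) / (R * (b^2-a^2)) := by
  have hn : -(a+b) < 0 := by linarith
  have hba : b - a ≠ 0 := sub_ne_zero.mpr hab.symm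
  have hba2 : b^2 - a^2 ≠ 0 := by
    rw [sq_sub_sq]; exact mul_ne_zero (by positivity) hba
  have hsplit : Set.Ioi (0:ℝ) = Set.Ioc 0 R ∪ Set.Ioi R := (Set.Ioc_union_Ioi_eq_Ioi hR.le).symm
  have c1 : Set.EqOn (fun r => exp (-a*r) * ((exp (-b * |r-R|) - exp (-b * (r+R))) / (b * R)))
     (fun r => (exp (-b*R) * exp ((b-a)*r) - exp (-b*R) * exp (-(a+b)*r)) / (b*R)) (Set.Ioc 0 R) := by
    intro r hr
    simp only
    rw [abs_of_nonpos (by linarith [hr.2]), mul_div_assoc', mul_sub]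
    simp only [← exp_add]
    ring_nf
  have c2 : Set.EqOn (fun r => exp (-a*r) * ((exp (-b * |r-R|) - exp (-b * (r+R))) / (b * R)))
     (fun r => ((exp (b*R) - exp (-b*R)) / (b*R)) * exp (-(a+b)*r)) (Set.Ioi R) := by
    intro r hr
    have hr : R < r := hr
    simp only
    rw [abs_of_pos (by linarith), mul_div_assoc', mul_sub, div_mul_eq_mul_div, sub_mul]
    simp only [← exp_add]
    ring_nf
  have i1 : IntegrableOn (fun r => exp (-a*r) * ((exp (-b * |r-R|) - exp (-b * (r+R))) / (b * R))) (Set.Ioc 0 R) :=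
    (Continuous.integrableOn_Icc (by fun_prop)).mono_set Set.Ioc_subset_Icc_self
  have i2 : IntegrableOn (fun r => exp (-a*r) * ((exp (-b * |r-R|) - exp (-b * (r+R))) / (b * R))) (Set.Ioi R) := by
    rw [integrableOn_congr_fun c2 measurableSet_Ioi]
    exact (integrableOn_exp_mul_Ioi hn R).const_mul _
  have ie : ∀ c : ℝ, c ≠ 0 → ∫ r in (0:ℝ)..R, exp (c*r) = (exp (c*R) - 1)/c := by
    intro c hc
    rw [intervalIntegral.integral_comp_mul_left _ hc, integral_exp]
    simp [div_eq_inv_mul]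
  refine ⟨hsplit ▸ i1.union i2, ?_⟩
  rw [hsplit, setIntegral_union (Set.Ioc_disjoint_Ioi le_rfl) measurableSet_Ioi i1 i2,
    setIntegral_congr_fun measurableSet_Ioc c1, setIntegral_congr_fun measurableSet_Ioi c2,
    integral_const_mul, integral_exp_mul_Ioi hn, ← intervalIntegral.integral_of_le hR.le,
    intervalIntegral.integral_div, intervalIntegral.integral_sub
      (Continuous.intervalIntegrable (by fun_prop) _ _) (Continuous.intervalIntegrable (by fun_prop) _ _),
    intervalIntegral.integral_const_mul, intervalIntegral.integral_const_mul, ie _ hba, ie _ hn.ne]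
  have x1 : exp ((b-a)*R) = exp (-a*R) * exp (b*R) := by rw [← exp_add]; ring_nf
  have x2 : exp (-(a+b)*R) = exp (-a*R) * exp (-b*R) := by rw [← exp_add]; ring_nf
  have x3 : exp (-b*R) = (exp (b*R))⁻¹ := by rw [← exp_neg]; ring_nf
  rw [x1, x2, x3]
  have hy := exp_pos (b*R)
  generalize exp (b*R) = y at *
  generalize exp (-a*R) = w at *
  have hs : a + b ≠ 0 := by positivity
  have : b^2-a^2 = (b-a)*(a+b) := by ring
  rw [this]
  field_simp
  ring

theorem stmt_18 (η₁ η₂ : ℝ) (hη₁ : 0 < η₁) (hη₂ : 0 < η₂) (hne : η₁ ≠ η₂)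
    (x₂ : EuclideanSpace ℝ (Fin 3)) (hx₂ : x₂ ≠ 0) :
    (∫ x : EuclideanSpace ℝ (Fin 3),
        (Real.exp (-η₁ * ‖x‖) / ‖x‖) * (Real.exp (-η₂ * ‖x - x₂‖) / ‖x - x₂‖))
    = 4 * Real.pi * (Real.exp (-η₁ * ‖x₂‖) - Real.exp (-η₂ * ‖x₂‖)) /
        (‖x₂‖ * (η₂ ^ 2 - η₁ ^ 2)) := by
  have hR : 0 < ‖x₂‖ := norm_pos_iff.mpr hx₂
  rw [integral_eq_lintegral_of_nonneg_ae (Filter.Eventually.of_forall fun x => by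
      simp only [Pi.zero_apply]; positivity) (Measurable.aestronglyMeasurable (by fun_prop))]
  rw [lemD (fun r s => ENNReal.ofReal ((exp (-η₁ * r) / r) * (exp (-η₂ * s) / s)))
    (by simp only [Function.uncurry_def]; fun_prop) x₂ hx₂]
  set R := ‖x₂‖
  obtain ⟨hi, hv⟩ := lemF η₁ η₂ R hη₁ hη₂ hne hR
  have hnn : ∀ r : ℝ, 0 < r → 0 ≤ exp (-η₁*r) * ((exp (-η₂ * |r-R|) - exp (-η₂ * (r+R))) / (η₂ * R)) := by
    intro r hr
    have : exp (-η₂ * (r+R)) ≤ exp (-η₂ * |r-R|) := by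
      apply exp_le_exp.mpr
      have : |r-R| ≤ r+R := abs_le.mpr ⟨by linarith, by linarith⟩
      nlinarith
    have := sub_nonneg.mpr this
    positivity
  have key : ∫⁻ r in Set.Ioi (0:ℝ), ENNReal.ofReal r *
      ∫⁻ z in Set.Ioo (-r) r, ENNReal.ofReal ((exp (-η₁ * r) / r) * (exp (-η₂ * √(r^2 - 2*z*R+R^2)) / √(r^2 - 2*z*R+R^2)))
      = ENNReal.ofReal (2 * (exp (-η₁*R) - exp (-η₂*R)) / (R * (η₂^2-η₁^2))) := by
    rw [← hv, ofReal_integral_eq_lintegral_ofReal hi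
      ((ae_restrict_iff' measurableSet_Ioi).mpr (Filter.Eventually.of_forall hnn))]
    apply setLIntegral_congr_fun_ae measurableSet_Ioi
    have hae : ∀ᵐ r : ℝ, r ≠ R := by
      simp [ae_iff]
    filter_upwards [hae] with r hrR hr
    have hr : 0 < r := hr
    have hq : 0 ≤ exp (-η₁ * r) / r := by positivity
    simp_rw [ENNReal.ofReal_mul hq]
    rw [lintegral_const_mul' _ _ ENNReal.ofReal_ne_top, lemE η₂ R r hη₂ hR hr hrR, ← mul_assoc,
      ← ENNReal.ofReal_mul hr.le, mul_div_cancel₀ _ hr.ne', ← ENNReal.ofReal_mul (exp_pos _).le]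
  rw [key, ENNReal.toReal_mul, ENNReal.toReal_ofReal (by positivity), ENNReal.toReal_ofReal]
  · ring
  · rw [← hv]
    exact setIntegral_nonneg measurableSet_Ioi hnn
end

section
/- Let η be a positive real and let x₂ be a nonzero vector in ℝ³. Then the integral over all of ℝ³ of (exp(-η·‖x‖)/‖x‖)·(exp(-η·‖x - x₂‖)/‖x - x₂‖) with respect to x equals 2·π·exp(-η·‖x₂‖)/η. -/
open MeasureTheory Real

/-- Polar coordinates for functions of the squared radius. -/
lemma yuk_polar (H : ℝ → ENNReal) (hH : Measurable H) :
    ∫⁻ p : ℝ × ℝ, H (p.1 ^ 2 + p.2 ^ 2) = ENNReal.ofReal π * ∫⁻ s in Set.Ioi (0:ℝ), H s := by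
  have himg : (fun r : ℝ => r ^ 2) '' Set.Ioi 0 = Set.Ioi 0 := by
    ext s
    constructor
    · rintro ⟨r, hr, rfl⟩
      have hr : 0 < r := hr
      exact pow_pos hr 2
    · intro hs
      exact ⟨√s, Real.sqrt_pos.2 hs, Real.sq_sqrt (le_of_lt hs)⟩
  have h1 : ∫⁻ s in Set.Ioi (0:ℝ), H s
      = ∫⁻ r in Set.Ioi (0:ℝ), ENNReal.ofReal |2 * r| * H (r ^ 2) := by
    conv_lhs => rw [← himg]
    refine lintegral_image_eq_lintegral_abs_deriv_mul measurableSet_Ioi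
      (f' := fun r => 2 * r) ?_ ?_ H
    · intro x _
      simpa using (hasDerivAt_pow 2 x).hasDerivWithinAt
    · intro a ha b hb hab
      exact (pow_left_inj₀ (le_of_lt ha) (le_of_lt hb) two_ne_zero).1 hab
  rw [← lintegral_comp_polarCoord_symm, polarCoord_target, h1, Measure.volume_eq_prod,
    setLIntegral_prod]
  · rw [← lintegral_const_mul _ (by fun_prop)]
    refine setLIntegral_congr_fun measurableSet_Ioi ?_
    intro r hr
    have hr : 0 < r := hr
    have e : ∀ θ : ℝ, ENNReal.ofReal r • H ((polarCoord.symm (r, θ)).1 ^ 2 +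
        (polarCoord.symm (r, θ)).2 ^ 2) = ENNReal.ofReal r * H (r ^ 2) := by
      intro θ
      have : (polarCoord.symm (r, θ)).1 ^ 2 + (polarCoord.symm (r, θ)).2 ^ 2 = r ^ 2 := by
        simp only [polarCoord_symm_apply]
        linear_combination r ^ 2 * (cos_sq_add_sin_sq θ)
      rw [this, smul_eq_mul]
    simp only [e]
    rw [setLIntegral_const, Real.volume_Ioo, abs_of_pos (by positivity), sub_neg_eq_add, mul_comm, ← mul_assoc,
      ← mul_assoc, ← ENNReal.ofReal_mul (by positivity), ← ENNReal.ofReal_mul (by positivity)]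
    congr 2
    ring
  · simp only [polarCoord_symm_apply, smul_eq_mul]
    fun_prop

/-- Cylindrical coordinates. -/
lemma yuk_cyl (K : ℝ × ℝ → ENNReal) (hK : Measurable K) :
    ∫⁻ x : EuclideanSpace ℝ (Fin 3), K ((x 1) ^ 2 + (x 2) ^ 2, x 0)
      = ENNReal.ofReal π * ∫⁻ p in Set.Ioi (0:ℝ) ×ˢ Set.univ, K p := by
  have h1 := (PiLp.volume_preserving_ofLp (Fin 3)).lintegral_comp_emb
    (MeasurableEquiv.toLp 2 (Fin 3 → ℝ)).symm.measurableEmbedding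
    (fun y : Fin 3 → ℝ => K ((y 1) ^ 2 + (y 2) ^ 2, y 0))
  have h2 := (volume_preserving_piFinSuccAbove (fun _ : Fin 3 => ℝ) 0).lintegral_comp_emb
    (MeasurableEquiv.measurableEmbedding _)
    (fun y : ℝ × (Fin 2 → ℝ) => K ((y.2 0) ^ 2 + (y.2 1) ^ 2, y.1))
  have h3 : ∀ z : ℝ, _ := fun z =>
    (volume_preserving_finTwoArrow ℝ).lintegral_comp_emb
    (MeasurableEquiv.measurableEmbedding _)
    (fun y : ℝ × ℝ => K (y.1 ^ 2 + y.2 ^ 2, z))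
  refine h1.trans (Eq.trans ?_ (h2.trans ?_))
  · rfl
  · rw [Measure.volume_eq_prod, lintegral_prod _ (by fun_prop)]
    have h4 : ∀ z : ℝ, ∫⁻ y : Fin 2 → ℝ, K ((y 0) ^ 2 + (y 1) ^ 2, z)
        = ENNReal.ofReal π * ∫⁻ s in Set.Ioi (0:ℝ), K (s, z) := by
      intro z
      rw [← yuk_polar (fun s => K (s, z)) (by fun_prop)]
      exact h3 z
    simp only [h4]
    rw [lintegral_const_mul, Measure.volume_eq_prod, setLIntegral_prod_symm _ (by fun_prop),
      setLIntegral_univ]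
    exact Measurable.lintegral_prod_left' (f := K) hK

/-- Prolate spheroidal change of variables. -/
lemma yuk_sph (R : ℝ) (hR : 0 < R) (G : ℝ → ℝ → ENNReal) :
    ∫⁻ p in Set.Ioi (0:ℝ) ×ˢ Set.univ, G √(p.1 + p.2 ^ 2) √(p.1 + (p.2 - R) ^ 2)
      = ∫⁻ q in Set.Ioi R ×ˢ Set.Ioo (-R) R, ENNReal.ofReal ((q.1 ^ 2 - q.2 ^ 2) / (4 * R)) *
        G ((q.1 + q.2) / 2) ((q.1 - q.2) / 2) := by
  set f : ℝ × ℝ → ℝ × ℝ := fun q =>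
    ((q.1 ^ 2 - R ^ 2) * (R ^ 2 - q.2 ^ 2) / (4 * R ^ 2), (q.1 * q.2 + R ^ 2) / (2 * R)) with hf
  have hr1 : ∀ q ∈ Set.Ioi R ×ˢ Set.Ioo (-R) R,
      √((f q).1 + (f q).2 ^ 2) = (q.1 + q.2) / 2 := by
    rintro ⟨u, v⟩ ⟨hu, hv⟩
    simp only [Set.mem_Ioi, Set.mem_Ioo] at hu hv
    rw [Real.sqrt_eq_iff_mul_self_eq_of_pos (by simp only; linarith)]
    simp only [hf]
    field_simp
    ring
  have hr2 : ∀ q ∈ Set.Ioi R ×ˢ Set.Ioo (-R) R,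
      √((f q).1 + ((f q).2 - R) ^ 2) = (q.1 - q.2) / 2 := by
    rintro ⟨u, v⟩ ⟨hu, hv⟩
    simp only [Set.mem_Ioi, Set.mem_Ioo] at hu hv
    rw [Real.sqrt_eq_iff_mul_self_eq_of_pos (by simp only; linarith)]
    simp only [hf]
    field_simp
    ring
  have hinj : Set.InjOn f (Set.Ioi R ×ˢ Set.Ioo (-R) R) := by
    intro a ha b hb hab
    have e1 := hr1 a ha
    have e2 := hr2 a ha
    rw [hab, hr1 b hb] at e1
    rw [hab, hr2 b hb] at e2
    ext <;> linarith
  have himg : f '' (Set.Ioi R ×ˢ Set.Ioo (-R) R) = Set.Ioi (0:ℝ) ×ˢ Set.univ := by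
    ext ⟨s, z⟩
    constructor
    · rintro ⟨⟨u, v⟩, ⟨hu, hv⟩, h⟩
      simp only [Set.mem_Ioi, Set.mem_Ioo] at hu hv
      simp only [hf, Prod.mk.injEq] at h
      refine ⟨?_, trivial⟩
      simp only [Set.mem_Ioi]
      rw [← h.1]
      have : 0 < u ^ 2 - R ^ 2 := by nlinarith
      have : 0 < R ^ 2 - v ^ 2 := by nlinarith
      positivity
    · rintro ⟨hs, _⟩
      have hs : 0 < s := hs
      have ha2 : √(s + z ^ 2) ^ 2 = s + z ^ 2 := Real.sq_sqrt (by positivity)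
      have hb2 : √(s + (z - R) ^ 2) ^ 2 = s + (z - R) ^ 2 := Real.sq_sqrt (by positivity)
      have ha : |z| < √(s + z ^ 2) := by
        rw [← Real.sqrt_sq_eq_abs]
        exact Real.sqrt_lt_sqrt (by positivity) (by linarith)
      have hb : |z - R| < √(s + (z - R) ^ 2) := by
        rw [← Real.sqrt_sq_eq_abs]
        exact Real.sqrt_lt_sqrt (by positivity) (by linarith)
      set a := √(s + z ^ 2)
      set b := √(s + (z - R) ^ 2)
      rw [abs_lt] at ha hb
      have hab : 0 < a + b - R := by linarith
      have hprod : (a - b) * (a + b) = R * (2 * z - R) := by nlinarith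
      have ha0 : 0 < a := by linarith
      have hb0 : 0 < b := by linarith
      refine ⟨(a + b, a - b), ⟨?_, ?_, ?_⟩, ?_⟩
      · simp only [Set.mem_Ioi]; linarith
      · simp only
        by_contra hcon
        push Not at hcon
        nlinarith
      · simp only
        by_contra hcon
        push Not at hcon
        nlinarith
      · have hz : ((a + b) * (a - b) + R ^ 2) / (2 * R) = z := by
          field_simp
          linarith
        simp only [hf, Prod.mk.injEq]
        refine ⟨?_, hz⟩
        have key : ((a + b) ^ 2 - R ^ 2) * (R ^ 2 - (a - b) ^ 2) / (4 * R ^ 2)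
            = a ^ 2 - (((a + b) * (a - b) + R ^ 2) / (2 * R)) ^ 2 := by
          field_simp
          ring
        rw [key, hz]
        linarith
  have hder : ∀ q ∈ Set.Ioi R ×ˢ Set.Ioo (-R) R, HasFDerivWithinAt f
      ((Matrix.toLin (.finTwoProd ℝ) (.finTwoProd ℝ)
        !![2 * q.1 * (R ^ 2 - q.2 ^ 2) / (4 * R ^ 2), -(2 * q.2 * (q.1 ^ 2 - R ^ 2)) / (4 * R ^ 2);
          q.2 / (2 * R), q.1 / (2 * R)]).toContinuousLinearMap)
      (Set.Ioi R ×ˢ Set.Ioo (-R) R) q := by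
    intro q _
    apply HasFDerivAt.hasFDerivWithinAt
    rw [Matrix.toLin_finTwoProd_toContinuousLinearMap]
    have d1 : HasFDerivAt (fun q : ℝ × ℝ => q.1) (ContinuousLinearMap.fst ℝ ℝ ℝ) q :=
      hasFDerivAt_fst
    have d2 : HasFDerivAt (fun q : ℝ × ℝ => q.2) (ContinuousLinearMap.snd ℝ ℝ ℝ) q :=
      hasFDerivAt_snd
    have D := HasFDerivAt.prodMk
      ((((d1.pow 2).sub_const (R ^ 2)).mul ((d2.pow 2).const_sub (R ^ 2))).mul_const (4 * R ^ 2)⁻¹)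
      (((d1.mul d2).add_const (R ^ 2)).mul_const (2 * R)⁻¹)
    refine HasFDerivAt.congr_fderiv (f := f) D ?_
    ext <;> simp <;> field_simp
  rw [← himg, lintegral_image_eq_lintegral_abs_det_fderiv_mul volume
    (measurableSet_Ioi.prod measurableSet_Ioo) hder hinj]
  refine setLIntegral_congr_fun (measurableSet_Ioi.prod measurableSet_Ioo) ?_
  intro q hq
  simp only
  rw [hr1 q hq, hr2 q hq]
  congr 2
  simp only [LinearMap.det_toContinuousLinearMap, LinearMap.det_toLin, Matrix.det_fin_two_of]
  obtain ⟨u, v⟩ := q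
  obtain ⟨hu, hv⟩ := hq
  simp only [Set.mem_Ioi, Set.mem_Ioo] at hu hv
  have e : 2 * u * (R ^ 2 - v ^ 2) / (4 * R ^ 2) * (u / (2 * R)) -
      -(2 * v * (u ^ 2 - R ^ 2)) / (4 * R ^ 2) * (v / (2 * R)) = (u ^ 2 - v ^ 2) / (4 * R) := by
    field_simp
    ring
  simp only
  rw [e, abs_of_pos]
  have : 0 < u ^ 2 - v ^ 2 := by nlinarith
  positivity

lemma yuk_final (η R : ℝ) (hη : 0 < η) (hR : 0 < R) :
    ∫⁻ q in Set.Ioi R ×ˢ Set.Ioo (-R) R, ENNReal.ofReal ((q.1 ^ 2 - q.2 ^ 2) / (4 * R)) *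
        ENNReal.ofReal ((Real.exp (-η * ((q.1 + q.2) / 2)) / ((q.1 + q.2) / 2)) *
          (Real.exp (-η * ((q.1 - q.2) / 2)) / ((q.1 - q.2) / 2)))
      = ENNReal.ofReal (2 * Real.exp (-η * R) / η) := by
  have h1 : ∫⁻ q in Set.Ioi R ×ˢ Set.Ioo (-R) R, ENNReal.ofReal ((q.1 ^ 2 - q.2 ^ 2) / (4 * R)) *
        ENNReal.ofReal ((Real.exp (-η * ((q.1 + q.2) / 2)) / ((q.1 + q.2) / 2)) *
          (Real.exp (-η * ((q.1 - q.2) / 2)) / ((q.1 - q.2) / 2)))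
      = ∫⁻ q in Set.Ioi R ×ˢ Set.Ioo (-R) R, ENNReal.ofReal (Real.exp (-η * q.1) / R) := by
    refine setLIntegral_congr_fun (measurableSet_Ioi.prod measurableSet_Ioo) ?_
    rintro ⟨u, v⟩ ⟨hu, hv⟩
    simp only [Set.mem_Ioi, Set.mem_Ioo] at hu hv
    simp only
    have p1 : 0 < u + v := by linarith
    have p2 : 0 < u - v := by linarith
    have p3 : 0 < u ^ 2 - v ^ 2 := by nlinarith
    rw [← ENNReal.ofReal_mul (by positivity)]
    congr 1
    have e : Real.exp (-η * u) = Real.exp (-η * ((u + v) / 2)) * Real.exp (-η * ((u - v) / 2)) := by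
      rw [← Real.exp_add]
      congr 1
      ring
    rw [e]
    field_simp
    ring
  rw [h1, Measure.volume_eq_prod, setLIntegral_prod _ (by fun_prop)]
  simp only [setLIntegral_const, Real.volume_Ioo]
  rw [lintegral_mul_const _ (by fun_prop), ← ofReal_integral_eq_lintegral_ofReal]
  · rw [integral_div, integral_exp_mul_Ioi (by linarith), ← ENNReal.ofReal_mul]
    · congr 1
      field_simp
      ring
    · have : -Real.exp (-η * R) / -η = Real.exp (-η * R) / η := by rw [neg_div_neg_eq]
      rw [this]
      positivity
  · exact (integrableOn_exp_mul_Ioi (by linarith) R).div_const R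
  · exact Filter.Eventually.of_forall fun x => by positivity

theorem stmt_19 (η : ℝ) (hη : 0 < η) (x₂ : EuclideanSpace ℝ (Fin 3)) (hx₂ : x₂ ≠ 0) :
    (∫ x : EuclideanSpace ℝ (Fin 3),
        (Real.exp (-η * ‖x‖) / ‖x‖) * (Real.exp (-η * ‖x - x₂‖) / ‖x - x₂‖))
    = 2 * Real.pi * Real.exp (-η * ‖x₂‖) / η := by
  have hR : 0 < ‖x₂‖ := norm_pos_iff.2 hx₂
  set R := ‖x₂‖ with hRdef
  set e : EuclideanSpace ℝ (Fin 3) := EuclideanSpace.single 0 R with he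
  have hne : ‖e‖ = ‖x₂‖ := by
    rw [he, EuclideanSpace.norm_single, Real.norm_eq_abs, abs_of_pos hR]
  set L := Submodule.reflection (Submodule.span ℝ {e - x₂})ᗮ
  have hL : L e = x₂ := Submodule.reflection_sub hne
  rw [← L.measurePreserving.integral_comp L.toHomeomorph.measurableEmbedding]
  have h1 : ∀ x, ‖L x - x₂‖ = ‖x - e‖ := by
    intro x
    rw [← hL, ← map_sub, L.norm_map]
  simp only [h1, L.norm_map]
  rw [integral_eq_lintegral_of_nonneg_ae]
  · have h2 : ∀ x : EuclideanSpace ℝ (Fin 3), ‖x‖ = √((x 1 ^ 2 + x 2 ^ 2) + x 0 ^ 2) := by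
      intro x
      rw [EuclideanSpace.norm_eq, Fin.sum_univ_three]
      simp only [Real.norm_eq_abs, sq_abs]
      congr 1
      ring
    have h3 : ∀ x : EuclideanSpace ℝ (Fin 3),
        ‖x - e‖ = √((x 1 ^ 2 + x 2 ^ 2) + (x 0 - R) ^ 2) := by
      intro x
      rw [h2]
      simp [he]
    have h4 := yuk_cyl (fun p => ENNReal.ofReal
      ((Real.exp (-η * √(p.1 + p.2 ^ 2)) / √(p.1 + p.2 ^ 2)) *
        (Real.exp (-η * √(p.1 + (p.2 - R) ^ 2)) / √(p.1 + (p.2 - R) ^ 2)))) (by fun_prop)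
    have h5 := yuk_sph R hR (fun a b => ENNReal.ofReal
      ((Real.exp (-η * a) / a) * (Real.exp (-η * b) / b)))
    simp only at h4 h5
    simp only [h3]
    simp only [h2]
    rw [h4, h5, yuk_final η R hη hR, ← ENNReal.ofReal_mul (by positivity),
      ENNReal.toReal_ofReal (by positivity)]
    ring
  · exact Filter.Eventually.of_forall fun x => by positivity
  · apply Measurable.aestronglyMeasurable
    fun_prop
end
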